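/- arXiv:1805.08049 — 4 statements merged into one kernel-verified Lean document; each statement's English description precedes it below -/
import Mathlib

section
/- Let O be an integral domain, p a prime number, h ≥ 1, q = p^h, and π ∈ O a nonzero element such that p ∈ πO and a^q ≡ a (mod πO) for every a ∈ O. Let σ be the O-algebra endomorphism of the polynomial ring O[X_i : i ∈ I] with σ(X_i) = X_i^q for all i. Suppose (h_n)_{n ≥ 0} is a sequence of polynomials in O[X_i : i ∈ I] such that σ(h_n) ≡ h_{n+1} (mod π^{n+1}·O[X_i : i ∈ I]) for all n ≥ 0. Then there exists a unique sequence of polynomials (g_n)_{n ≥ 0} in O[X_i : i ∈ I] such that Φ^{(π,q)}_n(g_0, …, g_n) = h_n for all n ≥ 0. -/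
open MvPolynomial

/-- The `n`-th ramified Witt polynomial with respect to `(π, q)`,
evaluated at a sequence `b`: `Φ^{(π,q)}_n(b) = ∑_{i=0}^{n} π^i b_i^{q^{n-i}}`. -/
def wittPhi {R : Type*} [CommRing R] (π : R) (q : ℕ) (n : ℕ) (b : ℕ → R) : R :=
  ∑ i ∈ Finset.range (n + 1), π ^ i * b i ^ q ^ (n - i)

theorem dvd_pow_sub_pow_of_dvd_sub {R : Type*} [CommRing R] {π a b : R} {q k : ℕ}
    (hq : π ∣ (q : R)) (hk : 1 ≤ k) (h : π ^ k ∣ a - b) : π ^ (k + 1) ∣ a ^ q - b ^ q := by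
  have hπ : π ∣ a - b := (dvd_pow_self π (by omega)).trans h
  rw [← (Commute.all a b).geom_sum₂_mul q, pow_succ']
  refine mul_dvd_mul ?_ h
  rw [← Ideal.mem_span_singleton, ← Ideal.Quotient.eq_zero_iff_mem] at hq ⊢
  rw [← Ideal.mem_span_singleton, ← Ideal.Quotient.eq] at hπ
  rw [RingHom.map_geom_sum₂, hπ, geom_sum₂_self, ← map_natCast (Ideal.Quotient.mk _), hq, zero_mul]

theorem dvd_pow_pow_sub_pow_pow {R : Type*} [CommRing R] {π a b : R} {q : ℕ}
    (hq : π ∣ (q : R)) (h : π ∣ a - b) (m : ℕ) : π ^ (m + 1) ∣ a ^ q ^ m - b ^ q ^ m := by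
  induction m with
  | zero => simpa using h
  | succ m ih =>
    rw [pow_succ q, pow_mul, pow_mul]
    exact dvd_pow_sub_pow_of_dvd_sub hq (by omega) ih

theorem wittPhi_eq_sum_add {R : Type*} [CommRing R] (π : R) (q n : ℕ) (b : ℕ → R) :
    wittPhi π q n b = ∑ i ∈ Finset.range n, π ^ i * b i ^ q ^ (n - i) + π ^ n * b n := by
  simp [wittPhi, Finset.sum_range_succ]

/-- The map `σ` shifts Witt polynomials by one step, modulo `π ^ (n + 1)`. -/
theorem dvd_map_wittPhi_sub_sum {R : Type*} [CommRing R] {π : R} {q : ℕ} (hq : π ∣ (q : R))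
    (σ : R →+* R) (hσπ : σ π = π) (hσ : ∀ a, π ∣ σ a - a ^ q) (n : ℕ) (g : ℕ → R) :
    π ^ (n + 1) ∣
      σ (wittPhi π q n g) - ∑ i ∈ Finset.range (n + 1), π ^ i * g i ^ q ^ (n + 1 - i) := by
  rw [wittPhi, map_sum, ← Finset.sum_sub_distrib]
  refine Finset.dvd_sum fun i hi => ?_
  have hin : i ≤ n := Nat.lt_succ_iff.mp (Finset.mem_range.mp hi)
  rw [map_mul, map_pow, map_pow, hσπ, ← mul_sub, show n + 1 - i = n - i + 1 by omega,
    pow_succ' q, pow_mul (g i), show n + 1 = i + (n - i + 1) by omega, pow_add π]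
  exact mul_dvd_mul_left _ (dvd_pow_pow_sub_pow_pow hq (hσ _) _)

/-- A solution of `wittPhi π q n g = H n`, obtained by successive division by the powers of `π`
(with junk values where the division is impossible). -/
noncomputable def wittPhiSolution {R : Type*} [CommRing R] (π : R) (q : ℕ) (H : ℕ → R) : ℕ → R
  | n => Function.invFun (fun x : R => π ^ n * x)
      (H n - ∑ i : Fin n, π ^ (i : ℕ) * wittPhiSolution π q H i ^ q ^ (n - i))
decreasing_by exact i.2

theorem wittPhi_wittPhiSolution {R : Type*} [CommRing R] {π : R} {q : ℕ} (hq : π ∣ (q : R))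
    (σ : R →+* R) (hσπ : σ π = π) (hσ : ∀ a, π ∣ σ a - a ^ q) (H : ℕ → R)
    (hH : ∀ n, π ^ (n + 1) ∣ σ (H n) - H (n + 1)) (n : ℕ) :
    wittPhi π q n (wittPhiSolution π q H) = H n := by
  have key : ∀ n, π ^ n ∣ H n -
      ∑ i ∈ Finset.range n, π ^ i * wittPhiSolution π q H i ^ q ^ (n - i) →
      wittPhi π q n (wittPhiSolution π q H) = H n := by
    rintro n ⟨x, hx⟩
    have := Function.invFun_eq (f := fun x : R => π ^ n * x) ⟨x, hx.symm⟩
    rw [← Fin.sum_univ_eq_sum_range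
      (fun i => π ^ i * wittPhiSolution π q H i ^ q ^ (n - i)), ← wittPhiSolution] at this
    rw [wittPhi_eq_sum_add, this, Fin.sum_univ_eq_sum_range
      (fun i => π ^ i * wittPhiSolution π q H i ^ q ^ (n - i)), add_sub_cancel]
  induction n with
  | zero => exact key 0 (by simp)
  | succ n ih =>
    refine key (n + 1) ?_
    have := dvd_sub (dvd_map_wittPhi_sub_sum hq σ hσπ hσ n (wittPhiSolution π q H)) (hH n)
    rwa [ih, sub_sub_sub_cancel_left] at this

theorem wittPhi_injective {R : Type*} [CommRing R] [IsDomain R] {π : R} (hπ : π ≠ 0) {q : ℕ}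
    {f g : ℕ → R} (hfg : ∀ n, wittPhi π q n f = wittPhi π q n g) : f = g := by
  funext n
  induction n using Nat.strong_induction_on with
  | _ n ih =>
    have := hfg n
    rw [wittPhi_eq_sum_add, wittPhi_eq_sum_add, Finset.sum_congr rfl fun i hi => by
      rw [ih i (Finset.mem_range.mp hi)]] at this
    exact mul_left_cancel₀ (pow_ne_zero n hπ) (add_left_cancel this)

theorem dvd_add_pow_prime_pow_sub {R : Type*} [CommRing R] {p : ℕ} (hp : p.Prime) (k : ℕ)
    {π : R} (hpπ : π ∣ (p : R)) (a b : R) :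
    π ∣ (a + b) ^ p ^ k - (a ^ p ^ k + b ^ p ^ k) := by
  obtain ⟨r, hr⟩ := exists_add_pow_prime_pow_eq hp a b k
  rw [hr, add_sub_cancel_left, mul_assoc, mul_assoc]
  exact hpπ.mul_right _

theorem MvPolynomial.dvd_aeval_X_pow_sub_pow {O I : Type*} [CommRing O] {p : ℕ} (hp : p.Prime)
    (k : ℕ) {π : O} (hpπ : π ∣ (p : O)) (hO : ∀ a : O, π ∣ a ^ p ^ k - a) (f : MvPolynomial I O) :
    C π ∣ aeval (fun i => (X i : MvPolynomial I O) ^ p ^ k) f - f ^ p ^ k := by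
  induction f using MvPolynomial.induction_on with
  | C a =>
    rw [aeval_C, algebraMap_eq, ← C_pow, ← C_sub]
    exact map_dvd C (dvd_sub_comm.mp (hO a))
  | add f g hf hg =>
    have hC : (C π : MvPolynomial I O) ∣ (p : MvPolynomial I O) := by
      simpa using map_dvd (C : O →+* MvPolynomial I O) hpπ
    have := dvd_sub (dvd_add hf hg) (dvd_add_pow_prime_pow_sub hp k hC f g)
    convert this using 1
    rw [map_add]
    ring
  | mul_X f i hf =>
    rw [map_mul, aeval_X, mul_pow, ← sub_mul]
    exact hf.mul_right _

theorem stmt_2 {O : Type*} [CommRing O] [IsDomain O] (p : ℕ) (hp : p.Prime)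
    (h : ℕ) (hh : 1 ≤ h) (q : ℕ) (hq : q = p ^ h) (π : O) (hπ : π ≠ 0)
    (hpπ : (p : O) ∈ Ideal.span {π})
    (hO : ∀ a : O, a ^ q - a ∈ Ideal.span {π})
    {I : Type*} (H : ℕ → MvPolynomial I O)
    (hH : ∀ n : ℕ,
      MvPolynomial.aeval (fun i => (MvPolynomial.X i : MvPolynomial I O) ^ q) (H n) - H (n + 1)
        ∈ Ideal.span ({(MvPolynomial.C π : MvPolynomial I O) ^ (n + 1)} : Set (MvPolynomial I O))) :
    ∃! g : ℕ → MvPolynomial I O,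
      ∀ n : ℕ, wittPhi (MvPolynomial.C π) q n g = H n := by
  subst hq
  simp only [Ideal.mem_span_singleton] at hpπ hO hH
  have hq : (C π : MvPolynomial I O) ∣ ((p ^ h : ℕ) : MvPolynomial I O) := by
    have := map_dvd (C : O →+* MvPolynomial I O)
      (hpπ.trans (dvd_pow_self (p : O) (by omega : h ≠ 0)))
    simpa using this
  refine ⟨wittPhiSolution (C π) (p ^ h) H, ?_, fun g hg => ?_⟩
  all_goals
    have hsol := wittPhi_wittPhiSolution hq
      (aeval fun i => (X i : MvPolynomial I O) ^ p ^ h : MvPolynomial I O →ₐ[O] _).toRingHom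
      (by simp) (dvd_aeval_X_pow_sub_pow hp h hpπ hO) H hH
  · exact hsol
  · exact wittPhi_injective (C_ne_zero.mpr hπ) fun n => (hg n).trans (hsol n).symm
end

section
/- Let O be an integral domain, p a prime number, h ≥ 1, q = p^h, and π ∈ O a nonzero element such that p ∈ πO and a^q ≡ a (mod πO) for every a ∈ O. Let λ ∈ O. Then there exists a unique sequence of polynomials (λ_n)_{n ≥ 0} in the polynomial ring O[X_0, X_1, X_2, …] such that Φ^{(π,q)}_n(λ_0, …, λ_n) = λ · Φ^{(π,q)}_n(X_0, …, X_n) for all n ≥ 0. (This family defines the multiplication-by-λ endomorphism of the group scheme of ramified Witt vectors over O.) -/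
open MvPolynomial

theorem wittPhi_congr {R : Type*} [CommRing R] (π : R) (q n : ℕ) {b c : ℕ → R}
    (hbc : ∀ i ≤ n, b i = c i) : wittPhi π q n b = wittPhi π q n c :=
  Finset.sum_congr rfl fun i hi => by rw [hbc i (Nat.lt_succ_iff.mp (Finset.mem_range.mp hi))]

/-- The components of a vector are determined by its ghost components when `π` is regular. -/
theorem eq_of_wittPhi_eq {R : Type*} [CommRing R] [IsDomain R] {π : R} (hπ : π ≠ 0) (q n : ℕ)
    {b c : ℕ → R} (hbc : ∀ k ≤ n, wittPhi π q k b = wittPhi π q k c) : b n = c n := by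
  induction n using Nat.strong_induction_on with
  | _ n ih =>
    have hlt : ∀ i < n, b i = c i := fun i hi => ih i hi fun k hk => hbc k (hk.trans hi.le)
    have h := hbc n le_rfl
    rw [wittPhi_eq_sum_add, wittPhi_eq_sum_add, Finset.sum_congr rfl fun i hi => by
      rw [hlt i (Finset.mem_range.mp hi)]] at h
    exact mul_left_cancel₀ (pow_ne_zero n hπ) (add_left_cancel h)

theorem pow_succ_dvd_pow_sub_pow {R : Type*} [CommRing R] {π a b : R} {q k : ℕ}
    (hq : π ∣ (q : R)) (hk : k ≠ 0) (hab : π ^ k ∣ a - b) : π ^ (k + 1) ∣ a ^ q - b ^ q := by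
  have hsum : π ∣ ∑ i ∈ Finset.range q, a ^ i * b ^ (q - 1 - i) :=
    (dvd_geom_sum₂_iff_of_dvd_sub ((dvd_pow_self π hk).trans hab)).2 (hq.mul_right _)
  rw [← (Commute.all a b).geom_sum₂_mul, pow_succ']
  exact mul_dvd_mul hsum hab

theorem pow_succ_dvd_pow_pow_sub_pow_pow {R : Type*} [CommRing R] {π a b : R} {q : ℕ}
    (hq : π ∣ (q : R)) (hab : π ∣ a - b) (m : ℕ) :
    π ^ (m + 1) ∣ a ^ q ^ m - b ^ q ^ m := by
  induction m with
  | zero => simpa using hab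
  | succ m ih =>
    simpa only [pow_succ q, pow_mul] using pow_succ_dvd_pow_sub_pow hq m.succ_ne_zero ih

/-- If `ψ` lifts the `q`-power Frobenius modulo `π`, applying `ψ` to a ghost component gives the
next one modulo `π ^ (n + 1)`. -/
theorem pow_succ_dvd_sum_sub_map_wittPhi {R : Type*} [CommRing R] {π : R} {q : ℕ}
    (hq : π ∣ (q : R)) (ψ : R →+* R) (hψπ : ψ π = π) (hψ : ∀ a, π ∣ a ^ q - ψ a)
    (n : ℕ) (b : ℕ → R) :
    π ^ (n + 1) ∣
      ∑ i ∈ Finset.range (n + 1), π ^ i * b i ^ q ^ (n + 1 - i) - ψ (wittPhi π q n b) := by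
  rw [wittPhi, map_sum, ← Finset.sum_sub_distrib]
  refine Finset.dvd_sum fun i hi => ?_
  have hi : i ≤ n := Nat.lt_succ_iff.mp (Finset.mem_range.mp hi)
  rw [map_mul, map_pow, map_pow, hψπ, ← mul_sub, Nat.succ_sub hi, pow_succ' q, pow_mul,
    show n + 1 = i + (n - i + 1) by omega, pow_add]
  exact mul_dvd_mul_left _ (pow_succ_dvd_pow_pow_sub_pow_pow hq (hψ _) _)

/-- Dwork's lemma for ramified Witt vectors. -/
theorem existsUnique_wittPhi_eq {R : Type*} [CommRing R] [IsDomain R] {π : R} (hπ : π ≠ 0) {q : ℕ}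
    (hq : π ∣ (q : R)) (ψ : R →+* R) (hψπ : ψ π = π) (hψ : ∀ a, π ∣ a ^ q - ψ a)
    (w : ℕ → R) (hw : ∀ n, π ^ (n + 1) ∣ w (n + 1) - ψ (w n)) :
    ∃! b : ℕ → R, ∀ n, wittPhi π q n b = w n := by
  have hprefix : ∀ n, ∃ b : ℕ → R, ∀ k ≤ n, wittPhi π q k b = w k := by
    intro n
    induction n with
    | zero => exact ⟨fun _ => w 0, fun k hk => by simp [Nat.le_zero.mp hk, wittPhi]⟩
    | succ n ih =>
      obtain ⟨b, hb⟩ := ih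
      have hdvd := dvd_sub (hw n) (pow_succ_dvd_sum_sub_map_wittPhi hq ψ hψπ hψ n b)
      rw [hb n le_rfl, sub_sub_sub_cancel_right] at hdvd
      obtain ⟨x, hx⟩ := hdvd
      refine ⟨Function.update b (n + 1) x, fun k hk => ?_⟩
      rcases hk.lt_or_eq with hk | rfl
      · rw [← hb k (Nat.lt_succ_iff.mp hk)]
        exact wittPhi_congr _ _ _ fun i hi => Function.update_of_ne (by omega) _ _
      · rw [wittPhi_eq_sum_add, Function.update_self, ← hx, Finset.sum_congr rfl fun i hi => by
          rw [Function.update_of_ne (Finset.mem_range.mp hi).ne], add_sub_cancel]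
  choose b hb using hprefix
  refine ⟨fun n => b n n, fun n => ?_, fun c hc => funext fun n => ?_⟩
  · rw [← hb n n le_rfl]
    exact wittPhi_congr _ _ _ fun i hi => eq_of_wittPhi_eq hπ q i fun k hk => by
      rw [hb i k hk, hb n k (hk.trans hi)]
  · exact eq_of_wittPhi_eq hπ q n fun k hk => by rw [hc k, hb n k hk]

/-- `MvPolynomial.expand q` lifts the `q`-power Frobenius modulo `π`. -/
theorem C_dvd_pow_sub_expand {O σ : Type*} [CommRing O] {p h : ℕ} (hp : p.Prime) {π : O}
    (hpπ : π ∣ (p : O)) (hO : ∀ a : O, π ∣ a ^ p ^ h - a) (f : MvPolynomial σ O) :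
    C π ∣ f ^ p ^ h - expand (p ^ h) f := by
  have hpC : (C π : MvPolynomial σ O) ∣ (p : MvPolynomial σ O) := by
    simpa using map_dvd (C : O →+* MvPolynomial σ O) hpπ
  induction f using MvPolynomial.induction_on with
  | C a => simpa using map_dvd (C : O →+* MvPolynomial σ O) (hO a)
  | add f g hf hg =>
    obtain ⟨r, hr⟩ := exists_add_pow_prime_pow_eq hp f g h
    rw [hr, map_add, show f ^ p ^ h + g ^ p ^ h + p * f * g * r
      - (expand (p ^ h) f + expand (p ^ h) g)
      = (f ^ p ^ h - expand (p ^ h) f) + (g ^ p ^ h - expand (p ^ h) g) + p * f * g * r by ring]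
    exact dvd_add (dvd_add hf hg) (((hpC.mul_right f).mul_right g).mul_right r)
  | mul_X f i hf =>
    rw [mul_pow, map_mul, expand_X, ← sub_mul]
    exact hf.mul_right _

theorem stmt_4 {O : Type*} [CommRing O] [IsDomain O] (p : ℕ) (hp : p.Prime)
    (h : ℕ) (hh : 1 ≤ h) (q : ℕ) (hq : q = p ^ h) (π : O) (hπ : π ≠ 0)
    (hpπ : (p : O) ∈ Ideal.span {π})
    (hO : ∀ a : O, a ^ q - a ∈ Ideal.span {π}) (lam : O) :
    ∃! L : ℕ → MvPolynomial ℕ O,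
      ∀ n : ℕ, wittPhi (MvPolynomial.C π) q n L
        = MvPolynomial.C lam * wittPhi (MvPolynomial.C π) q n (fun i => MvPolynomial.X i) := by
  subst hq
  simp only [Ideal.mem_span_singleton] at hpπ hO
  have hpC : (C π : MvPolynomial ℕ O) ∣ ((p ^ h : ℕ) : MvPolynomial ℕ O) := by
    have := map_dvd (C : O →+* MvPolynomial ℕ O) (dvd_pow hpπ (by omega : h ≠ 0))
    simpa using this
  refine existsUnique_wittPhi_eq (C_ne_zero.mpr hπ) hpC
    (expand (p ^ h) : MvPolynomial ℕ O →ₐ[O] MvPolynomial ℕ O).toRingHom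
    (expand_C _ π) (C_dvd_pow_sub_expand hp hpπ hO) _ fun n => ?_
  have hexpand : expand (p ^ h) (wittPhi (C π) (p ^ h) n fun i => (X i : MvPolynomial ℕ O)) =
      ∑ i ∈ Finset.range (n + 1), C π ^ i * X i ^ (p ^ h) ^ (n + 1 - i) := by
    rw [wittPhi, map_sum]
    refine Finset.sum_congr rfl fun i hi => ?_
    rw [map_mul, map_pow, map_pow, expand_C, expand_X,
      Nat.succ_sub (Nat.lt_succ_iff.mp (Finset.mem_range.mp hi)), pow_succ' (p ^ h), pow_mul]
  refine ⟨C lam * X (n + 1), ?_⟩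
  change _ - expand (p ^ h) _ = _
  rw [map_mul, expand_C, hexpand, wittPhi_eq_sum_add]
  ring
end

section
/- Let O' be an integral domain, p a prime number, h ≥ 1, q = p^h, e ≥ 1 an integer, ϖ ∈ O' nonzero with p ∈ ϖO' and a^q ≡ a (mod ϖO') for every a ∈ O', and let π = α·ϖ^e where α is a unit of O'. Let (u^{ra}_m)_{m ≥ 0} be the unique sequence of polynomials in O'[X_{n,i} : n ≥ 0, 0 ≤ i ≤ e−1] satisfying Φ^{(ϖ,q)}_m(u^{ra}_0, …, u^{ra}_m) = Σ_{j=0}^{e−1} ϖ^j · Φ^{(π,q)}_m(X_{0,j}, X_{1,j}, …, X_{m,j}) for all m ≥ 0. Then, in O'[X_{n,i} : n ≥ 0, 0 ≤ i ≤ e−1], the ideal generated by ϖ together with all u^{ra}_m (m ≥ 0) is equal to the ideal generated by ϖ together with all monomials X_{n,i}^{q^{n(e−1)+i}} (n ≥ 0, 0 ≤ i ≤ e−1). -/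
open MvPolynomial

/-- If the ghost components of `u` below `m` vanish to the expected order along a non-zero-divisor
`w`, then the `m`-th entry is determined modulo `w` by the `m`-th ghost component. -/
theorem dvd_sub_of_dvd_wittPhi {B : Type*} [CommRing B] {w : B} (hw : w ∈ nonZeroDivisors B)
    {q : ℕ} (hq : 1 < q) (u : ℕ → B) (m : ℕ)
    (hlt : ∀ n < m, w ^ (n + 1) ∣ wittPhi w q n u) (y : B)
    (hm : w ^ (m + 1) ∣ wittPhi w q m u - w ^ m * y) : w ∣ u m - y := by
  induction m using Nat.strong_induction_on generalizing y with
  | _ m ih =>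
  have hu : ∀ n < m, w ∣ u n := fun n hn => by
    simpa using ih n hn (fun k hk => hlt k (hk.trans hn)) 0 (by simpa using hlt n hn)
  have hsum : w ^ (m + 1) ∣ ∑ i ∈ Finset.range m, w ^ i * u i ^ q ^ (m - i) := by
    refine Finset.dvd_sum fun i hi => ?_
    have him := Finset.mem_range.1 hi
    have hlt' : m - i < q ^ (m - i) := Nat.lt_pow_self hq
    calc w ^ (m + 1) ∣ w ^ (i + q ^ (m - i)) := pow_dvd_pow _ (by omega)
      _ = w ^ i * w ^ q ^ (m - i) := pow_add _ _ _
      _ ∣ _ := mul_dvd_mul_left _ (pow_dvd_pow_of_dvd (hu i him) _)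
  obtain ⟨c, hc⟩ := dvd_sub hm hsum
  refine ⟨c, ?_⟩
  have hwm : w ^ m ∈ nonZeroDivisors B := pow_mem hw m
  rw [← mul_cancel_left_mem_nonZeroDivisors hwm]
  rw [wittPhi, Finset.sum_range_succ, Nat.sub_self, pow_zero, pow_one] at hc
  linear_combination hc

/-- Non-zero constants can be cancelled modulo monomial ideals. -/
theorem mem_span_monomial_of_C_mul_mem {σ R : Type*} [CommRing R] [IsDomain R] {w : R}
    (hw : w ≠ 0) (s : Set (σ →₀ ℕ)) {f : MvPolynomial σ R}
    (hf : C w * f ∈ Ideal.span ((fun d => monomial d (1 : R)) '' s)) :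
    f ∈ Ideal.span ((fun d => monomial d (1 : R)) '' s) := by
  rw [mem_ideal_span_monomial_image] at hf ⊢
  intro d hd
  refine hf d ?_
  rw [mem_support_iff, coeff_C_mul] at *
  exact mul_ne_zero hw hd

/-- The monomial `X_{n,i}^{q^{n(e-1)+i}}`. -/
noncomputable def kernelMonomial (R : Type*) [CommRing R] (q e : ℕ) (ni : ℕ × Fin e) :
    MvPolynomial (ℕ × Fin e) R :=
  X ni ^ q ^ (ni.1 * (e - 1) + (ni.2 : ℕ))

/-- The ideal generated by the monomials `X_{n,i}^{q^{n(e-1)+i}}` with `e * n + i < m`. -/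
noncomputable def kernelIdeal (R : Type*) [CommRing R] (q e m : ℕ) :
    Ideal (MvPolynomial (ℕ × Fin e) R) :=
  Ideal.span (kernelMonomial R q e '' {ni | e * ni.1 + (ni.2 : ℕ) < m})

section

variable {R : Type*} [CommRing R] {q e : ℕ}

theorem kernelMonomial_mem_kernelIdeal {m : ℕ} {ni : ℕ × Fin e}
    (h : e * ni.1 + (ni.2 : ℕ) < m) : kernelMonomial R q e ni ∈ kernelIdeal R q e m :=
  Ideal.subset_span ⟨ni, h, rfl⟩

theorem kernelIdeal_mono {m n : ℕ} (h : m ≤ n) : kernelIdeal R q e m ≤ kernelIdeal R q e n :=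
  Ideal.span_mono (Set.image_mono fun _ hx => lt_of_lt_of_le hx h)

theorem mem_kernelIdeal_of_C_mul_mem [IsDomain R] {w : R} (hw : w ≠ 0) {m : ℕ}
    {f : MvPolynomial (ℕ × Fin e) R} (hf : C w * f ∈ kernelIdeal R q e m) :
    f ∈ kernelIdeal R q e m := by
  have key : kernelIdeal R q e m = Ideal.span ((fun d => monomial d (1 : R)) ''
      ((fun ni : ℕ × Fin e => Finsupp.single ni (q ^ (ni.1 * (e - 1) + (ni.2 : ℕ)))) ''
        {ni | e * ni.1 + (ni.2 : ℕ) < m})) := by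
    rw [kernelIdeal, Set.image_image]
    congr 2
    funext ni
    rw [kernelMonomial, X_pow_eq_monomial]
  rw [key] at hf ⊢
  exact mem_span_monomial_of_C_mul_mem hw _ hf

/-- The summand of index `ni` in the `n`-th ramified ghost component, with `π = α * w ^ e`. -/
theorem ghost_summand_eq (α w : R) (he : 1 ≤ e) {n : ℕ} {ni : ℕ × Fin e}
    (h : e * ni.1 + (ni.2 : ℕ) ≤ n) :
    (C w : MvPolynomial (ℕ × Fin e) R) ^ (ni.2 : ℕ) *
        (C (α * w ^ e) ^ ni.1 * X ni ^ q ^ (n - ni.1)) =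
      C w ^ (e * ni.1 + (ni.2 : ℕ)) * C (α ^ ni.1) *
        kernelMonomial R q e ni ^ q ^ (n - (e * ni.1 + (ni.2 : ℕ))) := by
  obtain ⟨d, rfl⟩ : ∃ d, e = d + 1 := ⟨e - 1, by omega⟩
  have hexp : n - ni.1 = ni.1 * d + ni.2 + (n - ((d + 1) * ni.1 + ni.2)) := by
    have : (d + 1) * ni.1 = ni.1 * d + ni.1 := by ring
    omega
  rw [kernelMonomial, ← pow_mul, ← pow_add, hexp, Nat.add_sub_cancel]
  simp only [map_mul, map_pow]
  ring

/-- Modulo `w ^ (n + 1)` and the monomials of lower rank, the `n`-th ramified ghost component is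
a single monomial. -/
theorem ghost_sub_mem (α w : R) (he : 1 ≤ e) (hq : 0 < q) (n : ℕ) (hn : n % e < e) :
    (∑ j : Fin e, (C w : MvPolynomial (ℕ × Fin e) R) ^ (j : ℕ) *
        wittPhi (C (α * w ^ e)) q n (fun k => X (k, j))) -
      C w ^ n * (C (α ^ (n / e)) * kernelMonomial R q e (n / e, ⟨n % e, hn⟩)) ∈
    Ideal.span {C w ^ (n + 1)} ⊔ kernelIdeal R q e n := by
  simp only [wittPhi, Finset.mul_sum]
  rw [← Finset.sum_product']
  have hmem : ((⟨n % e, hn⟩, n / e) : Fin e × ℕ) ∈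
      (Finset.univ : Finset (Fin e)) ×ˢ Finset.range (n + 1) := by
    simpa using Nat.lt_succ_of_le (Nat.div_le_self n e)
  have hrank : e * (n / e) + n % e = n := Nat.div_add_mod n e
  rw [← Finset.add_sum_erase _ _ hmem]
  have hterm := ghost_summand_eq (q := q) α w he (n := n) (ni := (n / e, ⟨n % e, hn⟩)) hrank.le
  simp only [hrank, Nat.sub_self, pow_zero, pow_one] at hterm
  rw [hterm, mul_assoc, add_sub_cancel_left]
  refine Ideal.sum_mem _ fun ji hji => ?_
  obtain ⟨j, i⟩ := ji
  rw [Finset.mem_erase] at hji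
  rcases lt_trichotomy (e * i + (j : ℕ)) n with hlt | heq | hgt
  · refine Ideal.mem_sup_right ?_
    rw [ghost_summand_eq (ni := (i, j)) α w he hlt.le]
    exact Ideal.mul_mem_left _ _ (Ideal.pow_mem_of_mem _ (kernelMonomial_mem_kernelIdeal hlt) _
      (pow_pos hq _))
  · refine absurd ?_ hji.1
    have hdiv : n / e = i := by
      rw [← heq, Nat.mul_add_div (by omega), Nat.div_eq_of_lt j.2, add_zero]
    have hmod : n % e = j := by
      rw [← heq, Nat.mul_add_mod, Nat.mod_eq_of_lt j.2]
    ext <;> simp [hdiv, hmod]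
  · refine Ideal.mem_sup_left (Ideal.mem_span_singleton.2 ?_)
    refine (pow_dvd_pow (C w) (Nat.succ_le_of_lt hgt)).trans
      ⟨C α ^ i * X (i, j) ^ q ^ (n - i), ?_⟩
    simp only [map_mul, map_pow]
    ring

theorem map_wittPhi {S : Type*} [CommRing S] (f : R →+* S) (π : R) (n : ℕ) (b : ℕ → R) :
    f (wittPhi π q n b) = wittPhi (f π) q n (fun k => f (b k)) := by
  simp [wittPhi]

/-- Modulo `w` and the monomials of lower rank, `u m` is a constant times the monomial of
rank `m`. -/
theorem sub_kernelMonomial_mem [IsDomain R] {α w : R} (hw : w ≠ 0) (he : 1 ≤ e) (hq : 1 < q)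
    {u : ℕ → MvPolynomial (ℕ × Fin e) R}
    (hu : ∀ m : ℕ, wittPhi (C w) q m u
        = ∑ j : Fin e, (C w : MvPolynomial (ℕ × Fin e) R) ^ (j : ℕ) *
            wittPhi (C (α * w ^ e)) q m (fun n => X (n, j)))
    (m : ℕ) (hm : m % e < e) :
    u m - C (α ^ (m / e)) * kernelMonomial R q e (m / e, ⟨m % e, hm⟩) ∈
      Ideal.span {C w} ⊔ kernelIdeal R q e m := by
  set I := kernelIdeal R q e m
  set mk := Ideal.Quotient.mk I
  have hreg : mk (C w) ∈ nonZeroDivisors (MvPolynomial (ℕ × Fin e) R ⧸ I) := by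
    rw [mem_nonZeroDivisors_iff_right]
    intro x hx
    obtain ⟨f, rfl⟩ := Ideal.Quotient.mk_surjective x
    rw [← map_mul, Ideal.Quotient.eq_zero_iff_mem, mul_comm] at hx
    exact Ideal.Quotient.eq_zero_iff_mem.2 (mem_kernelIdeal_of_C_mul_mem hw hx)
  have hdvd : ∀ (x f : MvPolynomial (ℕ × Fin e) R),
      mk x ∣ mk f ↔ f ∈ Ideal.span {x} ⊔ I := by
    intro x f
    rw [← Ideal.mem_span_singleton, ← Set.image_singleton, ← Ideal.map_span, sup_comm,
      Ideal.mem_quotient_iff_mem_sup, sup_comm]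
  have hghost : ∀ n ≤ m, mk (C w) ^ (n + 1) ∣ wittPhi (mk (C w)) q n (fun k => mk (u k)) -
      mk (C w) ^ n * mk (C (α ^ (n / e)) *
        kernelMonomial R q e (n / e, ⟨n % e, Nat.mod_lt n he⟩)) := by
    intro n hn
    rw [← map_wittPhi, ← map_pow mk, ← map_pow mk, ← map_mul mk, ← map_sub, hdvd, hu]
    exact sup_le_sup_left (kernelIdeal_mono hn) _
      (ghost_sub_mem α w he (by omega) n (Nat.mod_lt n he))
  rw [← hdvd, map_sub]
  refine dvd_sub_of_dvd_wittPhi hreg hq (fun k => mk (u k)) m (fun n hn => ?_) _ (hghost m le_rfl)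
  have hzero : mk (C (α ^ (n / e)) *
      kernelMonomial R q e (n / e, ⟨n % e, Nat.mod_lt n he⟩)) = 0 :=
    Ideal.Quotient.eq_zero_iff_mem.2 (Ideal.mul_mem_left _ _ (kernelMonomial_mem_kernelIdeal
      (by simpa only [Nat.div_add_mod] using hn)))
  simpa only [hzero, mul_zero, sub_zero] using hghost n hn.le

end

theorem stmt_9 {O' : Type*} [CommRing O'] [IsDomain O'] (p : ℕ) (hp : p.Prime)
    (h : ℕ) (hh : 1 ≤ h) (q : ℕ) (hq : q = p ^ h) (e : ℕ) (he : 1 ≤ e)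
    (ϖ : O') (hϖ : ϖ ≠ 0)
    (hpϖ : (p : O') ∈ Ideal.span {ϖ})
    (hO : ∀ a : O', a ^ q - a ∈ Ideal.span {ϖ})
    (α π : O') (hα : IsUnit α) (hπ : π = α * ϖ ^ e)
    (u : ℕ → MvPolynomial (ℕ × Fin e) O')
    (hu : ∀ m : ℕ, wittPhi (MvPolynomial.C ϖ) q m u
        = ∑ j : Fin e, (MvPolynomial.C ϖ : MvPolynomial (ℕ × Fin e) O') ^ (j : ℕ) *
            wittPhi (MvPolynomial.C π) q m (fun n => MvPolynomial.X (n, j))) :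
    Ideal.span ({(MvPolynomial.C ϖ : MvPolynomial (ℕ × Fin e) O')} ∪ Set.range u)
      = Ideal.span ({(MvPolynomial.C ϖ : MvPolynomial (ℕ × Fin e) O')} ∪
          Set.range (fun ni : ℕ × Fin e =>
            (MvPolynomial.X ni : MvPolynomial (ℕ × Fin e) O') ^
              q ^ (ni.1 * (e - 1) + (ni.2 : ℕ)))) := by
  subst hπ
  have hq1 : 1 < q := hq ▸ Nat.one_lt_pow (by omega) hp.one_lt
  have key := sub_kernelMonomial_mem hϖ he hq1 hu
  change _ = Ideal.span ({C ϖ} ∪ Set.range (kernelMonomial O' q e))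
  apply le_antisymm
  · set I := Ideal.span ({C ϖ} ∪ Set.range (kernelMonomial O' q e))
    refine Ideal.span_le.2 (Set.union_subset (fun x hx => Ideal.subset_span (Or.inl hx)) ?_)
    rintro _ ⟨m, rfl⟩
    have hle : Ideal.span {C ϖ} ⊔ kernelIdeal O' q e m ≤ I :=
      sup_le (Ideal.span_mono Set.subset_union_left)
        (Ideal.span_mono ((Set.image_subset_range _ _).trans Set.subset_union_right))
    have hmem : kernelMonomial O' q e (m / e, ⟨m % e, Nat.mod_lt m he⟩) ∈ I :=
      Ideal.subset_span (Or.inr ⟨_, rfl⟩)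
    exact (Submodule.sub_mem_iff_left I (Ideal.mul_mem_left _ _ hmem)).1
      (hle (key m (Nat.mod_lt m he)))
  · set J := Ideal.span ({C ϖ} ∪ Set.range u)
    have hJ : ∀ m, kernelIdeal O' q e m ≤ J := by
      intro m
      induction m with
      | zero => simp [kernelIdeal]
      | succ m ih =>
        refine Ideal.span_le.2 ?_
        rintro _ ⟨⟨i, j⟩, hij, rfl⟩
        rcases (Nat.lt_succ_iff.1 hij).lt_or_eq with hlt | rfl
        · exact ih (kernelMonomial_mem_kernelIdeal hlt)
        · have hle : Ideal.span {C ϖ} ⊔ kernelIdeal O' q e (e * i + j) ≤ J :=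
            sup_le (Ideal.span_mono Set.subset_union_left) ih
          have hmem := hle (key (e * i + j) (Nat.mod_lt _ he))
          simp only [Nat.mul_add_div he, Nat.div_eq_of_lt j.2, add_zero, Nat.mul_add_mod,
            Nat.mod_eq_of_lt j.2, Fin.eta] at hmem
          have humem : u (e * i + j) ∈ J := Ideal.subset_span (Or.inr ⟨_, rfl⟩)
          exact (Ideal.unit_mul_mem_iff_mem J ((hα.pow i).map C)).1
            ((Submodule.sub_mem_iff_right J humem).1 hmem)
    refine Ideal.span_le.2 (Set.union_subset (fun x hx => Ideal.subset_span (Or.inl hx)) ?_)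
    rintro _ ⟨ni, rfl⟩
    exact hJ _ (kernelMonomial_mem_kernelIdeal (Nat.lt_succ_self _))
end

section
/- Let k be a perfect field of characteristic p > 0, and let ψ : X → Y be a morphism of schemes over k such that for every perfect k-algebra A (i.e., a commutative k-algebra on which the Frobenius endomorphism x ↦ x^p is bijective), the induced map X(A) → Y(A) on A-valued points over k is a bijection. Then ψ is a universal homeomorphism: for every scheme Z over Y, the base-changed morphism X ×_Y Z → Z induces a homeomorphism on underlying topological spaces. -/
open AlgebraicGeometry CategoryTheory CategoryTheory.Limits

universe u

/-- Every point of `Y` with values in a ring on which `x ↦ x ^ p` is bijective lifts uniquely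
along `f : X ⟶ Y`. -/
def LiftsPerfectPoints (p : ℕ) {X Y : Scheme.{u}} (f : X ⟶ Y) : Prop :=
  ∀ (A : Type u) [CommRing A], Function.Bijective (fun x : A => x ^ p) →
    ∀ y : Spec (.of A) ⟶ Y, ∃! x : Spec (.of A) ⟶ X, x ≫ f = y

lemma LiftsPerfectPoints.pullback_snd {p : ℕ} {X Y Z : Scheme.{u}} {f : X ⟶ Y}
    (hf : LiftsPerfectPoints p f) (g : Z ⟶ Y) : LiftsPerfectPoints p (pullback.snd f g) := by
  intro A _ hA z
  obtain ⟨x, hx, hx'⟩ := hf A hA (z ≫ g)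
  refine ⟨pullback.lift x z hx, pullback.lift_snd _ _ _, fun w hw => ?_⟩
  apply pullback.hom_ext
  · rw [pullback.lift_fst]
    exact hx' _ (by simp only [Category.assoc, pullback.condition, reassoc_of% hw])
  · rw [pullback.lift_snd, hw]

instance isHomeomorph_isZariskiLocalAtTarget :
    IsZariskiLocalAtTarget (topologically IsHomeomorph) :=
  have : (topologically IsHomeomorph).RespectsIso :=
    topologically_respectsIso _ (fun e => e.isHomeomorph) (fun _ _ hf hg => hg.comp hf)
  topologically_isZariskiLocalAtTarget _
    (fun _ s hf _ h =>
      ⟨hf.restrictPreimage, h.isOpenMap.restrictPreimage s, h.bijective.1.restrictPreimage s,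
        h.bijective.2.restrictPreimage s⟩)
    (fun _ _ _ hU hf h => (hU.isHomeomorph_iff_restrictPreimage hf).mpr h)

lemma LiftsPerfectPoints.injective {p : ℕ} (hp : p.Prime) {X : Scheme.{u}} {B : Type u}
    [CommRing B] (hB : (p : B) = 0) {f : X ⟶ Spec (.of B)} (hf : LiftsPerfectPoints p f) :
    Function.Injective f := by
  have : Fact p.Prime := ⟨hp⟩
  suffices UniversallyInjective f from f.injective
  rw [UniversallyInjective.iff_diagonal, surjective_iff]
  intro z
  let K := AlgebraicClosure ((pullback f f).residueField z)
  let φ : Spec (.of K) ⟶ pullback f f :=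
    Spec.map (CommRingCat.ofHom (algebraMap ((pullback f f).residueField z) K)) ≫
      (pullback f f).fromSpecResidueField z
  have hpK : (p : K) = 0 := by
    simpa [hB] using (map_natCast (Spec.preimage (φ ≫ pullback.fst f f ≫ f)).hom p).symm
  have : CharP K p := (CharP.charP_iff_prime_eq_zero hp).mpr hpK
  have : PerfectRing K p := inferInstance
  have h₁ : φ ≫ pullback.fst f f = φ ≫ pullback.snd f f :=
    (hf K (PerfectRing.bijective_frobenius (R := K) (p := p)) _).unique
      (by rw [Category.assoc]) (by simp only [Category.assoc, pullback.condition])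
  have h₂ : φ = (φ ≫ pullback.fst f f) ≫ pullback.diagonal f := by cat_disch
  let c : Spec (.of K) := IsLocalRing.closedPoint K
  refine ⟨(φ ≫ pullback.fst f f) c, ?_⟩
  rw [← Scheme.Hom.comp_apply, ← h₂, Scheme.Hom.comp_apply, Scheme.fromSpecResidueField_apply]

lemma PerfectClosure.isHomeomorph_comap_of (p : ℕ) [Fact p.Prime] (B : Type u) [CommRing B]
    [CharP B p] : IsHomeomorph (PrimeSpectrum.comap (PerfectClosure.of B p)) := by
  have : IsPRadical (PerfectClosure.of B p) p := inferInstance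
  refine PrimeSpectrum.isHomeomorph_comap _ (fun x => ?_)
    ((IsPRadical.ker_le _ p).trans pNilradical_le_nilradical)
  obtain ⟨n, y, hy⟩ := IsPRadical.pow_mem (PerfectClosure.of B p) p x
  exact ⟨p ^ n, pow_pos (Fact.out : p.Prime).pos n, y, hy⟩

lemma LiftsPerfectPoints.isHomeomorph_of_spec {p : ℕ} (hp : p.Prime) {X : Scheme.{u}} {B : Type u}
    [CommRing B] (hB : (p : B) = 0) {f : X ⟶ Spec (.of B)} (hf : LiftsPerfectPoints p f) :
    IsHomeomorph f := by
  have : Fact p.Prime := ⟨hp⟩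
  rcases subsingleton_or_nontrivial B with _ | _
  · have : IsEmpty (Spec (.of B)) := inferInstanceAs (IsEmpty (PrimeSpectrum B))
    have : IsEmpty X := Function.isEmpty f
    exact ⟨f.continuous, fun _ _ => by convert isOpen_empty; exact Subsingleton.elim _ _,
      fun x => isEmptyElim x, fun x => isEmptyElim x⟩
  have : CharP B p := (CharP.charP_iff_prime_eq_zero hp).mpr hB
  let π := Spec.map (CommRingCat.ofHom (PerfectClosure.of B p))
  have hπ : IsHomeomorph π := PerfectClosure.isHomeomorph_comap_of p B
  obtain ⟨s, hs, -⟩ := hf (PerfectClosure B p)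
    (PerfectRing.bijective_frobenius (R := PerfectClosure B p) (p := p)) π
  have hfs : ∀ y, f (s y) = π y := fun y => by rw [← Scheme.Hom.comp_apply, hs]
  let e := hπ.homeomorph
  have hr : Function.RightInverse (s ∘ e.symm) f := fun y => by
    simp only [Function.comp_apply, hfs]
    exact e.apply_symm_apply y
  have hl : Function.LeftInverse (s ∘ e.symm) f :=
    hr.leftInverse_of_injective (hf.injective hp hB)
  exact (Homeomorph.mk ⟨f, s ∘ e.symm, hl, hr⟩ f.continuous
    (s.continuous.comp e.symm.continuous)).isHomeomorph

lemma LiftsPerfectPoints.isHomeomorph {p : ℕ} (hp : p.Prime) {k : Type u} [CommRing k]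
    (hk : (p : k) = 0) {X Y : Scheme.{u}} {f : X ⟶ Y} (sY : Y ⟶ Spec (.of k))
    (hf : LiftsPerfectPoints p f) : IsHomeomorph f := by
  change topologically IsHomeomorph f
  rw [IsZariskiLocalAtTarget.iff_of_openCover (P := topologically IsHomeomorph) Y.affineCover]
  intro i
  refine (hf.pullback_snd (Y.affineCover.f i)).isHomeomorph_of_spec hp ?_
  let φ := (Spec.preimage (Y.affineCover.f i ≫ sY)).hom
  exact (map_natCast φ p).symm.trans ((congrArg φ hk).trans (map_zero φ))

theorem stmt_13 (p : ℕ) (hp : p.Prime) (k : Type u) [Field k] [ExpChar k p]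
    [PerfectRing k p]
    (X Y : Scheme.{u}) (sX : X ⟶ Spec (CommRingCat.of k))
    (sY : Y ⟶ Spec (CommRingCat.of k))
    (ψ : X ⟶ Y) (hψ : ψ ≫ sY = sX)
    (hbij : ∀ (A : Type u) (_ : CommRing A) (_ : Algebra k A),
      Function.Bijective (fun x : A => x ^ p) →
      Function.Bijective
        (fun f : { f : Spec (CommRingCat.of A) ⟶ X //
              f ≫ sX = Spec.map (CommRingCat.ofHom (algebraMap k A)) } =>
          (⟨f.1 ≫ ψ, by rw [Category.assoc, hψ]; exact f.2⟩ :
            { g : Spec (CommRingCat.of A) ⟶ Y //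
              g ≫ sY = Spec.map (CommRingCat.ofHom (algebraMap k A)) }))) :
    ∀ (Z : Scheme.{u}) (g : Z ⟶ Y), IsHomeomorph (pullback.snd ψ g).base := by
  have hψ' : LiftsPerfectPoints p ψ := by
    intro A _ hA y
    let : Algebra k A := (Spec.preimage (y ≫ sY)).hom.toAlgebra
    have hy : y ≫ sY = Spec.map (CommRingCat.ofHom (algebraMap k A)) :=
      (Spec.map_preimage (y ≫ sY)).symm
    have hb := hbij A inferInstance inferInstance hA
    obtain ⟨x, hx⟩ := hb.2 ⟨y, hy⟩
    have hx' : x.1 ≫ ψ = y := congrArg Subtype.val hx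
    refine ⟨x.1, hx', fun x₂ (hx₂ : x₂ ≫ ψ = y) => ?_⟩
    have h₂ : x₂ ≫ sX = Spec.map (CommRingCat.ofHom (algebraMap k A)) := by
      rw [← hψ, reassoc_of% hx₂, hy]
    exact congrArg Subtype.val
      (hb.1 (a₁ := ⟨x₂, h₂⟩) (a₂ := x) (Subtype.ext (hx₂.trans hx'.symm)))
  have hk : (p : k) = 0 := by
    rcases ‹ExpChar k p› with _ | _
    · exact absurd hp Nat.not_prime_one
    · exact CharP.cast_eq_zero k p
  exact fun Z g => (hψ'.pullback_snd g).isHomeomorph hp hk (g ≫ sY)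
end
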